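/- Let X be a Banach space over ℝ whose density character (the least cardinality of a dense subset) is strictly less than ℵ_ω, such that for every closed linear subspace Y ⊆ X the quotient Banach space X/Y belongs to class (B). If X admits no uncountable biorthogonal system, then X has the countable separation property (CSP). -/

import Mathlib

open Set Cardinal Pointwise

/-- A Banach space `X` over `ℝ` has the countable separation property (CSP) if every set of
continuous linear functionals separating the points of `X` has a countable separating subset. -/
def HasCSP (X : Type*) [NormedAddCommGroup X] [NormedSpace ℝ X] : Prop :=
  ∀ F : Set (X →L[ℝ] ℝ),
    (∀ x : X, x ≠ 0 → ∃ f ∈ F, f x ≠ 0) →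
    ∃ F₀ : Set (X →L[ℝ] ℝ), F₀ ⊆ F ∧ F₀.Countable ∧
      ∀ x : X, x ≠ 0 → ∃ f ∈ F₀, f x ≠ 0

universe u

def ClassB (X : Type u) [NormedAddCommGroup X] [NormedSpace ℝ X] : Prop :=
  ∀ κ : Cardinal.{u}, Cardinal.aleph0 < κ → κ.IsRegular →
    ∀ Z : {σ : Ordinal // σ < κ.ord} → Submodule ℝ X,
      (∀ σ, IsClosed (Z σ : Set X)) →
      (∀ α β, α < β → Z β < Z α) →
      (⋂ σ, (Z σ : Set X)) = {0} →
      Bornology.IsBounded (⋂ σ, (Metric.closedBall (0 : X) 1 + (Z σ : Set X)))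

theorem WellFoundedLT.exists_forall_restrict {J A : Type*} [Preorder J] [WellFoundedLT J]
    (P : ∀ a : J, (Iio a → A) → A → Prop) (h : ∀ a g, ∃ y, P a g y) :
    ∃ f : J → A, ∀ a, P a (fun b ↦ f b) (f a) := by
  choose step hstep using h
  let F : ∀ a : J, (∀ b, b < a → A) → A := fun a ih ↦ step a fun b ↦ ih b.1 b.2
  refine ⟨(wellFounded_lt (α := J)).fix F, fun a ↦ ?_⟩
  rw [WellFounded.fix_eq]
  exact hstep a _

theorem Cardinal.IsRegular.exists_forall_le {κ : Cardinal.{u}} (hκ : κ.IsRegular) {ι : Type*}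
    (hι : Cardinal.lift.{u} #ι < Cardinal.lift κ) (h : ι → {σ : Ordinal.{u} // σ < κ.ord}) :
    ∃ s, ∀ i, h i ≤ s := by
  have hb : BddAbove (range fun i ↦ (h i).1) := ⟨κ.ord, by rintro _ ⟨i, rfl⟩; exact (h i).2.le⟩
  refine ⟨⟨⨆ i, (h i).1, Ordinal.lift_iSup_lt_of_lt_cof ?_ fun i ↦ (h i).2⟩,
    fun i ↦ le_ciSup hb i⟩
  rwa [← Ordinal.lift_cof, hκ.cof_ord]

theorem Cardinal.mk_Iio_lt_lift {κ : Cardinal.{u}} (σ : {σ : Ordinal.{u} // σ < κ.ord}) :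
    #(Iio σ) < Cardinal.lift.{u + 1} κ :=
  calc #(Iio σ) ≤ #(Iio σ.1) := Cardinal.mk_le_of_injective
          (f := fun τ : Iio σ ↦ (⟨τ.1.1, τ.2⟩ : Iio σ.1))
          (fun _ _ h ↦ Subtype.ext (Subtype.ext (Subtype.mk.inj h)))
    _ = Cardinal.lift.{u + 1} σ.1.card := Cardinal.mk_Iio_ordinal _
    _ < _ := Cardinal.lift_lt.2 (Cardinal.lt_ord.1 σ.2)

theorem Cardinal.isRegular_of_lt_aleph_omega0 {κ : Cardinal} (h0 : ℵ₀ < κ)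
    (hω : κ < Cardinal.aleph Ordinal.omega0) : κ.IsRegular := by
  obtain ⟨o, rfl⟩ := Cardinal.mem_range_aleph_iff.2 h0.le
  obtain ⟨n, rfl⟩ := Ordinal.lt_omega0.1 (Cardinal.aleph_lt_aleph.1 hω)
  cases n with
  | zero => simp at h0
  | succ n =>
    rw [Nat.cast_succ]
    exact Cardinal.isRegular_aleph_add_one _

theorem ClassB.of_linearIsometryEquiv {X Y : Type u} [NormedAddCommGroup X] [NormedSpace ℝ X]
    [NormedAddCommGroup Y] [NormedSpace ℝ Y] (e : X ≃ₗᵢ[ℝ] Y) (h : ClassB Y) : ClassB X := by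
  intro κ h0 hκ Z hcl hlt hinf
  have key := h κ h0 hκ (fun σ ↦ (Z σ).comap (e.symm.toLinearEquiv : Y →ₗ[ℝ] X))
    (fun σ ↦ (hcl σ).preimage e.symm.continuous)
    (fun α β hαβ ↦ ?_) ?_
  · obtain ⟨C, hC⟩ := isBounded_iff_forall_norm_le.1 key
    refine isBounded_iff_forall_norm_le.2 ⟨C, fun x hx ↦ ?_⟩
    rw [← e.norm_map]
    refine hC _ (mem_iInter.2 fun σ ↦ ?_)
    obtain ⟨b, hb, z, hz, rfl⟩ := mem_iInter.1 hx σ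
    exact ⟨e b, by simpa using hb, e z, by simpa using hz, by simp⟩
  · refine SetLike.lt_iff_le_and_exists.2 ?_
    obtain ⟨hle, x, hx, hx'⟩ := SetLike.lt_iff_le_and_exists.1 (hlt α β hαβ)
    exact ⟨Submodule.comap_mono hle, e x, by simpa using hx, by simpa using hx'⟩
  · ext y
    have := congrArg (e.symm y ∈ ·) hinf
    simpa using this

/-- The quotient by the zero subspace is isometric to the space itself. -/
def Submodule.quotientBotIsometry (X : Type*) [NormedAddCommGroup X] [NormedSpace ℝ X] :
    X ≃ₗᵢ[ℝ] (X ⧸ (⊥ : Submodule ℝ X)) where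
  toLinearEquiv := (Submodule.quotEquivOfEqBot ⊥ rfl).symm
  norm_map' x := by
    change ‖(Submodule.Quotient.mk x : X ⧸ (⊥ : Submodule ℝ X))‖ = ‖x‖
    refine le_antisymm (Submodule.Quotient.norm_mk_le _ x) (le_of_forall_pos_lt_add fun ε hε ↦ ?_)
    obtain ⟨m, hm, hlt⟩ := Submodule.Quotient.norm_mk_lt
      (Submodule.Quotient.mk x : X ⧸ (⊥ : Submodule ℝ X)) hε
    rw [Submodule.Quotient.eq, Submodule.mem_bot, sub_eq_zero] at hm
    exact hm ▸ hlt

theorem ClassB.exists_norm_le_mul_norm_sub {X : Type u} [NormedAddCommGroup X] [NormedSpace ℝ X]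
    (h : ClassB X) {κ : Cardinal.{u}} (h0 : ℵ₀ < κ) (hκ : κ.IsRegular)
    (Z : {σ : Ordinal.{u} // σ < κ.ord} → Submodule ℝ X)
    (hcl : ∀ σ, IsClosed (Z σ : Set X)) (hlt : ∀ α β, α < β → Z β < Z α)
    (hinf : ∀ x, (∀ σ, x ∈ Z σ) → x = 0) :
    ∃ K : ℝ, ∀ x, ∃ σ, ∀ z ∈ Z σ, ‖x‖ ≤ K * ‖x - z‖ := by
  have hb := h κ h0 hκ Z hcl hlt (by
    ext x
    simp only [mem_iInter, SetLike.mem_coe, mem_singleton_iff]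
    exact ⟨hinf x, by rintro rfl σ; exact zero_mem _⟩)
  obtain ⟨C, hC0, hC⟩ := hb.exists_pos_norm_le
  refine ⟨C + 1, fun x ↦ ?_⟩
  by_contra! hx
  obtain ⟨z, -, hz⟩ := hx ⟨0, hκ.ord_pos⟩
  have hxpos : 0 < ‖x‖ := lt_of_le_of_lt (by positivity) hz
  have hc : 0 < (C + 1) / ‖x‖ := by positivity
  have := hC (((C + 1) / ‖x‖) • x) (mem_iInter.2 fun σ ↦ ?_)
  · rw [norm_smul, Real.norm_of_nonneg hc.le, div_mul_cancel₀ _ hxpos.ne'] at this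
    linarith
  · obtain ⟨z, hz, hlt⟩ := hx σ
    refine ⟨((C + 1) / ‖x‖) • (x - z), ?_, ((C + 1) / ‖x‖) • z, (Z σ).smul_mem _ hz, ?_⟩
    · rw [mem_closedBall_zero_iff, norm_smul, Real.norm_of_nonneg hc.le, div_mul_eq_mul_div,
        div_le_one hxpos]
      exact hlt.le
    · simp [← smul_add]

section Biorthogonal

variable {X : Type*} [NormedAddCommGroup X] [NormedSpace ℝ X]

theorem exists_apply_eq_one_of_notMem {p : Submodule ℝ X} (hp : IsClosed (p : Set X)) {x : X}
    (hx : x ∉ p) : ∃ f : X →L[ℝ] ℝ, f x = 1 ∧ ∀ y ∈ p, f y = 0 := by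
  have : IsClosed (p : Set X) := hp
  obtain ⟨g, hg⟩ := SeparatingDual.exists_eq_one (R := ℝ) (x := p.mkQL x)
    (by simpa [Submodule.Quotient.mk_eq_zero] using hx)
  refine ⟨g.comp p.mkQL, hg, fun y hy ↦ ?_⟩
  have : p.mkQL y = 0 := by simpa [Submodule.Quotient.mk_eq_zero] using hy
  simp [this]

variable {I : Type*} [LinearOrder I] {Z : I → Submodule ℝ X} {K : ℝ}

theorem exists_forall_mem_span_norm_le (hI : ∀ h : ℕ → I, ∃ s, ∀ n, h n ≤ s)
    (hanti : Antitone Z) (hK : ∀ x, ∃ σ, ∀ z ∈ Z σ, ‖x‖ ≤ K * ‖x - z‖)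
    {s : Set X} (hs : s.Countable) :
    ∃ σ, ∀ w ∈ Submodule.span ℝ s, ∀ z ∈ Z σ, ‖w‖ ≤ K * ‖w - z‖ := by
  obtain ⟨c, hc, hsc⟩ : TopologicalSpace.IsSeparable (Submodule.span ℝ s : Set X) :=
    hs.isSeparable.span
  choose τ hτ using hK
  obtain ⟨d, hd⟩ := (hc.union (countable_singleton 0)).exists_eq_range (by simp)
  obtain ⟨σ, hσ⟩ := hI (τ ∘ d)
  refine ⟨σ, fun w hw z hz ↦ ?_⟩
  have hclosed : IsClosed {w : X | ‖w‖ ≤ K * ‖w - z‖} :=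
    isClosed_le (by fun_prop) (by fun_prop)
  refine closure_minimal (fun v hv ↦ ?_) hclosed (hsc hw)
  obtain ⟨n, rfl⟩ : v ∈ range d := hd ▸ Or.inl hv
  exact hτ _ z (hanti (hσ n) hz)

theorem exists_mem_notMem_closure_span_sup (hI : ∀ h : ℕ → I, ∃ s, ∀ n, h n ≤ s)
    (hcl : ∀ σ, IsClosed (Z σ : Set X)) (hanti : Antitone Z) (hne : ∀ σ, ∃ x ∈ Z σ, x ≠ 0)
    (hinf : ∀ x, (∀ σ, x ∈ Z σ) → x = 0) (hK : ∀ x, ∃ σ, ∀ z ∈ Z σ, ‖x‖ ≤ K * ‖x - z‖)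
    {ι : Type*} [Countable ι] (g : ι → X × I) :
    ∃ y : X × I, (∀ i, y.1 ∈ Z (g i).2) ∧
      y.1 ∉ (Submodule.span ℝ (range fun i ↦ (g i).1) ⊔ Z y.2).topologicalClosure := by
  obtain ⟨σ, hσ⟩ := exists_forall_mem_span_norm_le hI hanti hK
    (countable_range fun i ↦ (g i).1)
  obtain ⟨h, hh⟩ : ∃ h : ℕ → I, ∀ i, (g i).2 ∈ range h := by
    obtain ⟨h, hh⟩ := ((countable_range fun i ↦ (g i).2).union
      (countable_singleton σ)).exists_eq_range (by simp)
    exact ⟨h, fun i ↦ hh ▸ Or.inl ⟨i, rfl⟩⟩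
  obtain ⟨ρ, hρ⟩ := hI h
  obtain ⟨x, hx, hx0⟩ := hne (max σ ρ)
  obtain ⟨τ, hτ⟩ : ∃ τ, x ∉ Z τ := by
    by_contra! hall
    exact hx0 (hinf x hall)
  have hxσ : x ∈ Z σ := hanti (le_max_left _ _) hx
  have hστ : σ ≤ τ := by
    by_contra! hlt
    exact hτ (hanti hlt.le hxσ)
  refine ⟨(x, τ), fun i ↦ ?_, fun hmem ↦ hτ ?_⟩
  · obtain ⟨n, hn⟩ := hh i
    rw [← hn]
    exact hanti ((hρ n).trans (le_max_right _ _)) hx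
  · have hK' : ∀ y ∈ ((Submodule.span ℝ (range fun i ↦ (g i).1) ⊔ Z τ : Submodule ℝ X) : Set X),
        ∃ z ∈ Z τ, dist x z ≤ (K + 1) * dist x y := by
      intro y hy
      obtain ⟨w, hw, z, hz, rfl⟩ := Submodule.mem_sup.1 hy
      refine ⟨z, hz, ?_⟩
      have h1 := hσ w hw (x - z) (sub_mem hxσ (hanti hστ hz))
      have h2 : ‖x - z‖ ≤ ‖w‖ + ‖x - (w + z)‖ := by
        have := norm_add_le w (x - (w + z))
        rwa [show w + (x - (w + z)) = x - z by abel] at this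
      have h3 : ‖w - (x - z)‖ = ‖x - (w + z)‖ := by
        rw [← norm_neg]; congr 1; abel
      rw [h3] at h1
      rw [dist_eq_norm, dist_eq_norm]
      linarith
    obtain ⟨y, hy, hyx⟩ := mem_closure_iff_seq_limit.1 hmem
    choose z hz hzx using fun n ↦ hK' (y n) (hy n)
    refine (hcl τ).mem_of_tendsto (f := z) (b := Filter.atTop) ?_ (.of_forall hz)
    rw [tendsto_iff_dist_tendsto_zero] at hyx ⊢
    refine squeeze_zero (fun _ ↦ dist_nonneg) (fun n ↦ ?_)
      (by simpa using hyx.const_mul (K + 1))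
    rw [dist_comm, dist_comm (y n)]
    exact hzx n

theorem exists_biorthogonal {J : Type*} [LinearOrder J] [WellFoundedLT J]
    (hJ : ∀ a : J, (Iio a).Countable) (hI : ∀ h : ℕ → I, ∃ s, ∀ n, h n ≤ s)
    (hcl : ∀ σ, IsClosed (Z σ : Set X)) (hanti : Antitone Z) (hne : ∀ σ, ∃ x ∈ Z σ, x ≠ 0)
    (hinf : ∀ x, (∀ σ, x ∈ Z σ) → x = 0) (hK : ∀ x, ∃ σ, ∀ z ∈ Z σ, ‖x‖ ≤ K * ‖x - z‖) :
    ∃ (x : J → X) (f : J → (X →L[ℝ] ℝ)),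
      (∀ a, f a (x a) = 1) ∧ ∀ a b, a ≠ b → f a (x b) = 0 := by
  obtain ⟨p, hp⟩ := WellFoundedLT.exists_forall_restrict (J := J) (A := X × I)
    (fun a g y ↦ (∀ i, y.1 ∈ Z (g i).2) ∧
      y.1 ∉ (Submodule.span ℝ (range fun i ↦ (g i).1) ⊔ Z y.2).topologicalClosure)
    (fun a g ↦ by
      have := (hJ a).to_subtype
      exact exists_mem_notMem_closure_span_sup hI hcl hanti hne hinf hK g)
  choose f hf using fun a ↦ exists_apply_eq_one_of_notMem
    (Submodule.isClosed_topologicalClosure _) (hp a).2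
  refine ⟨fun a ↦ (p a).1, f, fun a ↦ (hf a).1, fun a b hab ↦
    (hf a).2 _ (Submodule.le_topologicalClosure _ ?_)⟩
  rcases hab.lt_or_gt with h | h
  · exact Submodule.mem_sup_right ((hp b).1 ⟨a, h⟩)
  · exact Submodule.mem_sup_left (Submodule.subset_span ⟨⟨b, h⟩, rfl⟩)

end Biorthogonal

/-- A set of functionals separates points if no nonzero vector is annihilated by all of them. -/
def SeparatesVectors {X : Type*} [NormedAddCommGroup X] [NormedSpace ℝ X]
    (F : Set (X →L[ℝ] ℝ)) : Prop :=
  ∀ x : X, x ≠ 0 → ∃ f ∈ F, f x ≠ 0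

theorem SeparatesVectors.exists_subset_mk_le {X : Type*} [NormedAddCommGroup X] [NormedSpace ℝ X]
    {F : Set (X →L[ℝ] ℝ)} (hF : SeparatesVectors F) {D : Set X} (hD : Dense D) :
    ∃ G ⊆ F, SeparatesVectors G ∧ #G ≤ #D * ℵ₀ := by
  let S : Set (D × ℕ) := {q | ∃ f ∈ F, ∀ y ∈ Metric.ball (q.1 : X) (1 / (q.2 + 1)), f y ≠ 0}
  choose g hg using fun q : S ↦ q.2
  refine ⟨range g, ?_, fun x hx ↦ ?_, Cardinal.mk_range_le.trans ?_⟩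
  · rintro _ ⟨q, rfl⟩
    exact (hg q).1
  · obtain ⟨f, hf, hfx⟩ := hF x hx
    obtain ⟨ε, hε, hball⟩ := Metric.isOpen_iff.1
      (isOpen_ne_fun f.continuous continuous_const : IsOpen {y | f y ≠ 0}) x hfx
    obtain ⟨n, hn⟩ := exists_nat_one_div_lt (half_pos hε)
    have hpos : (0 : ℝ) < 1 / (n + 1) := by positivity
    obtain ⟨d, hd, hdx⟩ := hD.exists_dist_lt x hpos
    have hq : ((⟨d, hd⟩, n) : D × ℕ) ∈ S := by
      refine ⟨f, hf, fun y hy ↦ hball ?_⟩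
      simp only [Metric.mem_ball] at hy ⊢
      have := dist_triangle y d x
      rw [dist_comm d x] at this
      linarith
    exact ⟨g ⟨_, hq⟩, ⟨_, rfl⟩, (hg ⟨_, hq⟩).2 x (by simpa using hdx)⟩
  · calc #S ≤ #(D × ℕ) := Cardinal.mk_set_le S
      _ = #D * ℵ₀ := by simp

theorem exists_strictAnti_of_minimal_separating {X : Type u} [NormedAddCommGroup X]
    [NormedSpace ℝ X] {F : Set (X →L[ℝ] ℝ)} (hF : SeparatesVectors F) (hreg : (#F).IsRegular)
    (hmin : ∀ G ⊆ F, SeparatesVectors G → #F ≤ #G) :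
    ∃ Z : {σ : Ordinal.{u} // σ < (#F).ord} → Submodule ℝ X,
      (∀ σ, IsClosed (Z σ : Set X)) ∧ (∀ α β, α < β → Z β < Z α) ∧
      (∀ σ, ∃ x ∈ Z σ, x ≠ 0) ∧ ∀ x, (∀ σ, x ∈ Z σ) → x = 0 := by
  let I := {σ : Ordinal.{u} // σ < (#F).ord}
  obtain ⟨r, hr, hord⟩ := Cardinal.exists_ord_eq F
  let e : F → I := fun f ↦ ⟨Ordinal.typein r f, hord ▸ Ordinal.typein_lt_type r f⟩
  have he : Function.Injective e := fun f g h ↦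
    Ordinal.typein_injective r (congrArg Subtype.val h)
  let W : I → Submodule ℝ X := fun σ ↦ ⨅ f : {f : F // e f < σ}, f.1.1.ker
  have hW : ∀ σ x, x ∈ W σ ↔ ∀ f : F, e f < σ → f.1 x = 0 := by
    intro σ x
    simp [W, Submodule.mem_iInf]
  have hWcl : ∀ σ, IsClosed (W σ : Set X) := by
    intro σ
    simp only [W, Submodule.coe_iInf]
    exact isClosed_iInter fun f ↦ f.1.1.isClosed_ker
  have hWanti : Antitone W := fun α β hαβ x hx ↦
    (hW _ _).2 fun f hf ↦ (hW _ _).1 hx f (hf.trans_le hαβ)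
  have hcard (σ : I) : #(Iio σ) < Cardinal.lift.{u + 1} #F := Cardinal.mk_Iio_lt_lift σ
  have hWne : ∀ σ, ∃ x ∈ W σ, x ≠ 0 := by
    intro σ
    by_contra! hall
    let G : Set (X →L[ℝ] ℝ) := Subtype.val '' {f : F | e f < σ}
    have hG : SeparatesVectors G := by
      intro x hx
      by_contra! hzero
      exact hx (hall x ((hW _ _).2 fun f hf ↦ hzero f ⟨f, hf, rfl⟩))
    have h1 := hmin G (by rintro _ ⟨f, -, rfl⟩; exact f.2) hG
    have h2 : Cardinal.lift.{u + 1} #{f : F | e f < σ} ≤ Cardinal.lift.{u} #(Iio σ) :=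
      Cardinal.lift_mk_le_lift_mk_of_injective
        (f := fun f : {f : F | e f < σ} ↦ (⟨e f.1, f.2⟩ : Iio σ))
        (fun a b h ↦ Subtype.ext (he (Subtype.mk.inj h)))
    have h3 : #G ≤ #{f : F | e f < σ} := Cardinal.mk_image_le
    have h4 := (Cardinal.lift_le.{u + 1}.2 (h1.trans h3)).trans h2
    rw [Cardinal.lift_id'.{u, u + 1}] at h4
    exact (hcard σ).not_ge h4
  have hWinf : ∀ x, (∀ σ, x ∈ W σ) → x = 0 := by
    intro x hx
    by_contra hx0
    obtain ⟨f, hf, hfx⟩ := hF x hx0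
    obtain ⟨s, hs⟩ : ∃ s : I, e ⟨f, hf⟩ < s :=
      ⟨⟨Order.succ (e ⟨f, hf⟩).1, (Cardinal.isSuccLimit_ord hreg.aleph0_le).succ_lt
        (e ⟨f, hf⟩).2⟩, Order.lt_succ (e ⟨f, hf⟩).1⟩
    exact hfx ((hW _ _).1 (hx s) ⟨f, hf⟩ hs)
  obtain ⟨φ, hφ⟩ := WellFoundedLT.exists_forall_restrict (J := I) (A := I)
    (fun a g y ↦ ∀ i, W y < W (g i) ∧ g i < y) (fun a g ↦ by
      obtain ⟨s, hs⟩ := hreg.exists_forall_le (ι := Iio a) (by rw [Cardinal.lift_id'.{u, u + 1}]; exact hcard a) g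
      obtain ⟨x, hx, hx0⟩ := hWne s
      obtain ⟨τ, hτ⟩ : ∃ τ, x ∉ W τ := by
        by_contra! hall
        exact hx0 (hWinf x hall)
      have hsτ : s < τ := by
        by_contra! hle
        exact hτ (hWanti hle hx)
      refine ⟨τ, fun i ↦ ⟨lt_of_le_of_ne (hWanti ((hs i).trans hsτ.le)) fun h ↦ hτ ?_,
        (hs i).trans_lt hsτ⟩⟩
      rw [h]
      exact hWanti (hs i) hx)
  have hmono : StrictMono φ := fun a b hab ↦ (hφ b ⟨a, hab⟩).2
  refine ⟨W ∘ φ, fun σ ↦ hWcl _, fun α β hαβ ↦ (hφ β ⟨α, hαβ⟩).1, fun σ ↦ hWne _, fun x hx ↦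
    hWinf x fun σ ↦ hWanti (hmono.le_apply) (hx σ)⟩

/-- If `X` has density `< ℵ_ω`, every quotient of `X` by a closed subspace is in class (B),
and `X` admits no uncountable biorthogonal system, then `X` has CSP. -/
theorem hasCSP_of_no_uncountable_biorthogonal (X : Type*) [NormedAddCommGroup X]
    [NormedSpace ℝ X] [CompleteSpace X]
    (hdens : ∃ D : Set X, Dense D ∧ Cardinal.mk D < Cardinal.aleph Ordinal.omega0)
    (hquot : ∀ (Y : Submodule ℝ X) [IsClosed (Y : Set X)], ClassB (X ⧸ Y))
    (hbio : ¬ ∃ (x : {σ : Ordinal // σ < (Cardinal.aleph 1).ord} → X)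
        (f : {σ : Ordinal // σ < (Cardinal.aleph 1).ord} → (X →L[ℝ] ℝ)),
        (∀ α, f α (x α) = 1) ∧ ∀ α β, α ≠ β → f α (x β) = 0) :
    HasCSP X := by
  have : IsClosed ((⊥ : Submodule ℝ X) : Set X) := isClosed_singleton
  have hB : ClassB X := (hquot ⊥).of_linearIsometryEquiv (Submodule.quotientBotIsometry X)
  intro F hF
  obtain ⟨D, hD, hDω⟩ := hdens
  let S : Set (Set (X →L[ℝ] ℝ)) := {G | G ⊆ F ∧ SeparatesVectors G}
  obtain ⟨G, ⟨hGF, hG⟩, hmin⟩ : ∃ G ∈ S, ∀ H ∈ S, #G ≤ #H :=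
    have hS : S.Nonempty := ⟨F, Subset.rfl, hF⟩
    ⟨_, Function.argminOn_mem (fun G : Set (X →L[ℝ] ℝ) ↦ #G) S hS,
      fun _ hH ↦ Function.argminOn_le (fun G : Set (X →L[ℝ] ℝ) ↦ #G) S hH⟩
  refine ⟨G, hGF, ?_, hG⟩
  by_contra hunc
  have h0 : ℵ₀ < #G := by rwa [← not_le, Cardinal.le_aleph0_iff_set_countable]
  have hω : #G < Cardinal.aleph Ordinal.omega0 := by
    obtain ⟨H, hHF, hH, hHD⟩ := SeparatesVectors.exists_subset_mk_le hF hD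
    exact (hmin H ⟨hHF, hH⟩).trans_lt (hHD.trans_lt
      (Cardinal.mul_lt_of_lt (Cardinal.aleph0_le_aleph _) hDω (by simp)))
  have hreg := Cardinal.isRegular_of_lt_aleph_omega0 h0 hω
  obtain ⟨Z, hcl, hlt, hne, hinf⟩ := exists_strictAnti_of_minimal_separating hG hreg
    fun H hHG hH ↦ hmin H ⟨hHG.trans hGF, hH⟩
  obtain ⟨K, hK⟩ := hB.exists_norm_le_mul_norm_sub h0 hreg Z hcl hlt hinf
  have hanti : StrictAnti Z := fun α β ↦ hlt α β
  refine hbio (exists_biorthogonal (fun a ↦ ?_) (fun h ↦ hreg.exists_forall_le (by simpa) h)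
    hcl hanti.antitone hne hinf hK)
  rw [← Cardinal.le_aleph0_iff_set_countable, ← Cardinal.lt_aleph_one_iff]
  simpa using Cardinal.mk_Iio_lt_lift a
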